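/- Let δ > 0 and k be a positive integer. If N is sufficiently large (depending on δ and k), then every subset A of the k-dimensional grid {1,2,…,N}^k of size at least δN^k contains a set of points of the form {a} ∪ {a + d·e_i : 1 ≤ i ≤ k}, where e_1,…,e_k is the standard basis of ℤ^k and d is a non-zero integer. (Theorem 10.2.) -/

import Mathlib

open Finset

namespace DensityHalesJewett

open Combinatorics

/-! ### Averages over finite types -/

/-- The indicator of a proposition, as a real number. -/
noncomputable def ind (p : Prop) : ℝ := open Classical in if p then 1 else 0

lemma ind_of_true {p : Prop} (h : p) : ind p = 1 := by simp [ind, h]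

lemma ind_of_false {p : Prop} (h : ¬ p) : ind p = 0 := by simp [ind, h]

lemma ind_nonneg (p : Prop) : 0 ≤ ind p := by
  by_cases h : p <;> simp [ind, h]

lemma ind_le_one (p : Prop) : ind p ≤ 1 := by
  by_cases h : p <;> simp [ind, h]

lemma ind_mono {p q : Prop} (h : p → q) : ind p ≤ ind q := by
  by_cases hp : p
  · rw [ind_of_true hp, ind_of_true (h hp)]
  · rw [ind_of_false hp]; exact ind_nonneg q

/-- The average of a real-valued function over a finite type. -/
noncomputable def mean {X : Type*} [Finite X] (f : X → ℝ) : ℝ :=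
  letI := Fintype.ofFinite X
  (∑ x, f x) / Fintype.card X

section mean

variable {X Y : Type*} [Finite X] [Finite Y]

lemma mean_eq [Fintype X] (f : X → ℝ) : mean f = (∑ x, f x) / Fintype.card X := by
  unfold mean
  congr!

lemma mean_add (f g : X → ℝ) : mean (fun x => f x + g x) = mean f + mean g := by
  simp [mean, Finset.sum_add_distrib, add_div]

lemma mean_sub (f g : X → ℝ) : mean (fun x => f x - g x) = mean f - mean g := by
  simp [mean, Finset.sum_sub_distrib, sub_div]

lemma mean_const_mul (c : ℝ) (f : X → ℝ) : mean (fun x => c * f x) = c * mean f := by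
  simp only [mean, ← Finset.mul_sum, mul_div_assoc]

lemma mean_sum {T : Type*} (s : Finset T) (f : T → X → ℝ) :
    mean (fun x => ∑ t ∈ s, f t x) = ∑ t ∈ s, mean (f t) := by
  simp only [mean, Finset.sum_div]
  exact Finset.sum_comm

lemma mean_const [Nonempty X] (c : ℝ) : mean (fun _ : X => c) = c := by
  have := Fintype.ofFinite X
  rw [mean_eq]
  simp

lemma mean_mono {f g : X → ℝ} (h : ∀ x, f x ≤ g x) : mean f ≤ mean g := by
  unfold mean
  exact div_le_div_of_nonneg_right (Finset.sum_le_sum fun x _ => h x) (by positivity)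

lemma mean_nonneg {f : X → ℝ} (h : ∀ x, 0 ≤ f x) : 0 ≤ mean f := by
  unfold mean
  exact div_nonneg (Finset.sum_nonneg fun x _ => h x) (by positivity)

lemma mean_le [Nonempty X] {f : X → ℝ} {c : ℝ} (h : ∀ x, f x ≤ c) : mean f ≤ c :=
  (mean_mono h).trans_eq (mean_const c)

lemma mean_nonpos {f : X → ℝ} (h : ∀ x, f x ≤ 0) : mean f ≤ 0 := by
  have := mean_nonneg (f := fun x => 0 - f x) fun x => by linarith [h x]
  rw [mean_sub] at this
  have h0 : mean (fun _ : X => (0 : ℝ)) = 0 := by simp [mean]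
  linarith

lemma mean_ind_le_one (p : X → Prop) : mean (fun x => ind (p x)) ≤ 1 := by
  rcases isEmpty_or_nonempty X with h | h
  · simp [mean]
  · exact mean_le fun x => ind_le_one _

lemma exists_le_of_le_mean [Nonempty X] {f : X → ℝ} {c : ℝ} (h : c ≤ mean f) :
    ∃ x, c ≤ f x := by
  by_contra! hf
  have := Fintype.ofFinite X
  have hlt : ∑ x, f x < ∑ _x : X, c :=
    Finset.sum_lt_sum_of_nonempty Finset.univ_nonempty fun x _ => hf x
  rw [mean_eq, le_div_iff₀ (by positivity)] at h
  simp at hlt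
  linarith

lemma mean_comp_equiv (e : X ≃ Y) (f : Y → ℝ) : mean (fun x => f (e x)) = mean f := by
  have := Fintype.ofFinite X
  have := Fintype.ofFinite Y
  rw [mean_eq, mean_eq, Fintype.card_congr e, Equiv.sum_comp e f]

lemma mean_prod (f : X × Y → ℝ) : mean f = mean fun y => mean fun x => f (x, y) := by
  have := Fintype.ofFinite X
  have := Fintype.ofFinite Y
  simp only [mean_eq, Fintype.sum_prod_type_right, Fintype.card_prod, Nat.cast_mul,
    ← Finset.sum_div, div_div]

lemma mean_comm (f : X → Y → ℝ) :
    (mean fun x => mean fun y => f x y) = mean fun y => mean fun x => f x y := by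
  rw [← mean_prod (fun p : Y × X => f p.2 p.1), ← mean_prod (fun p : X × Y => f p.1 p.2),
    ← mean_comp_equiv (Equiv.prodComm X Y)]
  rfl

lemma mean_sumElim {ι κ α : Type*} [Finite ι] [Finite κ] [Finite α] (f : (ι ⊕ κ → α) → ℝ) :
    mean f = mean fun y : κ → α => mean fun x : ι → α => f (Sum.elim x y) := by
  rw [← mean_comp_equiv (Equiv.sumArrowEquivProdArrow ι κ α).symm, mean_prod]
  rfl

lemma mean_sumElim' {ι κ α : Type*} [Finite ι] [Finite κ] [Finite α] (f : (ι ⊕ κ → α) → ℝ) :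
    mean f = mean fun x : ι → α => mean fun y : κ → α => f (Sum.elim x y) := by
  rw [mean_sumElim, mean_comm]

/-- If a function bounded by `u` has average close to `u`, it is nowhere much smaller. -/
lemma le_apply_of_le_mean [Nonempty X] {f : X → ℝ} {u l : ℝ} (hf : ∀ x, f x ≤ u)
    (hl : l ≤ mean f) (x : X) : u - Nat.card X * (u - l) ≤ f x := by
  have := Fintype.ofFinite X
  rw [mean_eq, le_div_iff₀ (by positivity)] at hl
  have h1 : u - f x ≤ ∑ z, (u - f z) :=
    Finset.single_le_sum (f := fun z => u - f z) (fun z _ => by linarith [hf z])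
      (Finset.mem_univ x)
  rw [Finset.sum_sub_distrib] at h1
  simp at h1 ⊢
  nlinarith

/-- Markov's inequality combined with the pigeonhole principle. -/
lemma exists_popular {T : Type*} [Finite T] {h : X → ℝ} {δ : ℝ} (hδ : 0 < δ) (h1 : ∀ x, h x ≤ 1)
    (hm : δ ≤ mean h) (P : T → X → Prop) (hP : ∀ x, δ / 2 ≤ h x → ∃ t, P t x) :
    ∃ t, δ / (2 * (Nat.card T + 1)) ≤ mean fun x => ind (P t x) := by
  have := Fintype.ofFinite T
  by_contra! hc
  have hX : Nonempty X := by
    by_contra hX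
    rw [not_nonempty_iff] at hX
    simp [mean] at hm
    linarith
  have key : ∀ x, h x ≤ δ / 2 + ∑ t, ind (P t x) := by
    intro x
    have h0 : ∀ t ∈ Finset.univ, 0 ≤ ind (P t x) := fun t _ => ind_nonneg _
    by_cases hx : δ / 2 ≤ h x
    · obtain ⟨t, ht⟩ := hP x hx
      have := Finset.single_le_sum h0 (Finset.mem_univ t)
      rw [ind_of_true ht] at this
      linarith [h1 x]
    · have := Finset.sum_nonneg h0
      linarith
  have h2 := mean_mono key
  rw [mean_add, mean_const, mean_sum] at h2
  have h3 : ∑ t, mean (fun x => ind (P t x)) ≤ ∑ _t : T, δ / (2 * (Nat.card T + 1)) :=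
    Finset.sum_le_sum fun t _ => (hc t).le
  rw [Finset.sum_const, Finset.card_univ, ← Nat.card_eq_fintype_card, nsmul_eq_mul] at h3
  have h4 : (Nat.card T : ℝ) * (δ / (2 * (Nat.card T + 1))) < δ / 2 := by
    rw [mul_div_assoc', div_lt_div_iff₀ (by positivity) (by positivity)]
    nlinarith
  linarith

end mean

/-! ### Operations on combinatorial subspaces -/

section Subspace

variable {α η θ ι κ : Type*}

/-- Composition of combinatorial subspaces. -/
def comp (V : Subspace η α ι) (W : Subspace θ α η) : Subspace θ α ι where
  idxFun i := (V.idxFun i).elim Sum.inl W.idxFun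
  proper e := by
    obtain ⟨j, hj⟩ := W.proper e
    obtain ⟨i, hi⟩ := V.proper j
    exact ⟨i, by simp [hi, hj]⟩

@[simp] lemma comp_apply (V : Subspace η α ι) (W : Subspace θ α η) (x : θ → α) :
    comp V W x = V (W x) := by
  ext i
  cases h : V.idxFun i <;> simp [comp, Subspace.coe_apply, h]

/-- The product of two combinatorial subspaces. -/
def prod (V : Subspace η α ι) (W : Subspace θ α κ) : Subspace (η ⊕ θ) α (ι ⊕ κ) where
  idxFun := Sum.elim (fun i => (V.idxFun i).map id Sum.inl) fun i => (W.idxFun i).map id Sum.inr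
  proper := by
    rintro (e | e)
    · obtain ⟨i, hi⟩ := V.proper e
      exact ⟨Sum.inl i, by simp [hi]⟩
    · obtain ⟨i, hi⟩ := W.proper e
      exact ⟨Sum.inr i, by simp [hi]⟩

lemma prod_apply (V : Subspace η α ι) (W : Subspace θ α κ) (x : η ⊕ θ → α) :
    prod V W x = Sum.elim (V fun e => x (Sum.inl e)) (W fun e => x (Sum.inr e)) := by
  ext (i | i)
  · cases h : V.idxFun i <;> simp [prod, Subspace.coe_apply, h]
  · cases h : W.idxFun i <;> simp [prod, Subspace.coe_apply, h]

/-- Extend a combinatorial subspace by a constant word on the right. -/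
def horizontal (V : Subspace η α ι) (y : κ → α) : Subspace η α (ι ⊕ κ) where
  idxFun := Sum.elim V.idxFun fun i => Sum.inl (y i)
  proper e := (V.proper e).elim fun i hi => ⟨Sum.inl i, hi⟩

@[simp] lemma horizontal_apply (V : Subspace η α ι) (y : κ → α) (x : η → α) :
    horizontal V y x = Sum.elim (V x) y := by
  ext (i | i) <;> rfl

/-- Extend a combinatorial subspace by a constant word on the left. -/
def vertical (y : κ → α) (V : Subspace η α ι) : Subspace η α (κ ⊕ ι) where
  idxFun := Sum.elim (fun i => Sum.inl (y i)) V.idxFun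
  proper e := (V.proper e).elim fun i hi => ⟨Sum.inr i, hi⟩

@[simp] lemma vertical_apply (y : κ → α) (V : Subspace η α ι) (x : η → α) :
    vertical y V x = Sum.elim y (V x) := by
  ext (i | i) <;> rfl

/-- The combinatorial subspace over the alphabet with one more letter which is generated by
a given one. -/
def lift (V : Subspace η α ι) : Subspace η (Option α) ι where
  idxFun i := (V.idxFun i).map some id
  proper e := (V.proper e).elim fun i hi => ⟨i, by simp [hi]⟩

lemma lift_apply_some (V : Subspace η α ι) (x : η → α) :
    lift V (fun e => some (x e)) = fun i => some (V x i) := by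
  ext1 i
  cases h : V.idxFun i <;> simp [lift, Subspace.coe_apply, h]

lemma lift_apply_getD (V : Subspace η α ι) (x : η → Option α) (a : α) :
    (fun i => (lift V x i).getD a) = V fun e => (x e).getD a := by
  ext1 i
  cases h : V.idxFun i <;> simp [lift, Subspace.coe_apply, h]

lemma apply_getD_congr (V : Subspace η (Option α) ι) {x y : η → Option α} {a : α}
    (h : ∀ e, (x e).getD a = (y e).getD a) (i : ι) : (V x i).getD a = (V y i).getD a := by
  cases hi : V.idxFun i <;> simp [Subspace.coe_apply, hi, h]

lemma apply_injective (V : Subspace η α ι) : Function.Injective V := by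
  intro x y h
  ext e
  obtain ⟨i, hi⟩ := V.proper e
  simpa [Subspace.coe_apply, hi] using congrFun h i

instance [Finite α] [Finite η] [Finite ι] : Finite (Subspace η α ι) :=
  Finite.of_injective Subspace.idxFun fun _ _ => Subspace.ext

end Subspace

/-! ### Density statements -/

/-- `HasDenseSubspace η α δ` says that, in some finite dimension, every set of words over `α` of
density at least `δ` contains a combinatorial subspace with wildcard set `η`. -/
def HasDenseSubspace (η α : Type) [Finite α] (δ : ℝ) : Prop :=
  ∃ (ι : Type) (_ : Finite ι), ∀ A : Set (ι → α), δ ≤ mean (fun x => ind (x ∈ A)) →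
    ∃ V : Subspace η α ι, ∀ x, V x ∈ A

section HasDenseSubspace

variable {α : Type} [Finite α]

lemma HasDenseSubspace.mono {η : Type} {δ δ' : ℝ} (h : HasDenseSubspace η α δ) (hδ : δ ≤ δ') :
    HasDenseSubspace η α δ' := by
  obtain ⟨ι, hι, H⟩ := h
  exact ⟨ι, hι, fun A hA => H A (hδ.trans hA)⟩

lemma hasDenseSubspace_of_one_lt (η : Type) {δ : ℝ} (hδ : 1 < δ) : HasDenseSubspace η α δ :=
  ⟨Empty, inferInstance, fun _ hA => absurd (hA.trans (mean_ind_le_one _)) (not_le.2 hδ)⟩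

lemma HasDenseSubspace.reindex {η η' β : Type} [Finite β] (eη : η ≃ η') (eα : α ≃ β) {δ : ℝ}
    (h : HasDenseSubspace η α δ) : HasDenseSubspace η' β δ := by
  obtain ⟨ι, hι, H⟩ := h
  refine ⟨ι, hι, fun A hA => ?_⟩
  obtain ⟨V, hV⟩ := H {x | (fun i => eα (x i)) ∈ A} <| by
    rw [← mean_comp_equiv ((Equiv.refl ι).arrowCongr eα)] at hA
    exact hA
  refine ⟨V.reindex eη eα (Equiv.refl ι), fun x => ?_⟩
  have hx := hV (eα.symm ∘ x ∘ eη)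
  have hfun : V.reindex eη eα (Equiv.refl ι) x = fun i => eα (V (eα.symm ∘ x ∘ eη) i) := by
    ext1 i
    simp
  rw [hfun]
  exact hx

/-- Density statements hold in all sufficiently high dimensions. -/
lemma HasDenseSubspace.exists_forall_card [Nonempty α] {η : Type} {δ : ℝ}
    (h : HasDenseSubspace η α δ) :
    ∃ n : ℕ, ∀ (ι : Type) [Finite ι], n ≤ Nat.card ι → ∀ A : Set (ι → α),
      δ ≤ mean (fun x => ind (x ∈ A)) → ∃ V : Subspace η α ι, ∀ x, V x ∈ A := by
  obtain ⟨ι₀, _, H⟩ := h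
  refine ⟨Nat.card ι₀, fun ι _ hι A hA => ?_⟩
  have e : ι₀ ⊕ Fin (Nat.card ι - Nat.card ι₀) ≃ ι := by
    refine (Finite.card_eq.1 ?_).some
    rw [Nat.card_sum, Nat.card_fin]
    omega
  rw [← mean_comp_equiv (e.arrowCongr (Equiv.refl α)), mean_sumElim] at hA
  obtain ⟨y, hy⟩ := exists_le_of_le_mean hA
  obtain ⟨V, hV⟩ := H {x | (e.arrowCongr (Equiv.refl α)) (Sum.elim x y) ∈ A} hy
  refine ⟨(horizontal V y).reindex (Equiv.refl η) (Equiv.refl α) e, fun x => ?_⟩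
  have hx := hV x
  have hfun : (horizontal V y).reindex (Equiv.refl η) (Equiv.refl α) e x =
      (e.arrowCongr (Equiv.refl α)) (Sum.elim (V x) y) := by
    ext1 i
    rw [Subspace.reindex_apply, ← horizontal_apply]
    rfl
  rw [hfun]
  exact hx

/-- Subspaces in dense sets can be built one after the other. -/
lemma HasDenseSubspace.sum {η θ : Type} [Finite η] (hη : ∀ δ > 0, HasDenseSubspace η α δ)
    (hθ : ∀ δ > 0, HasDenseSubspace θ α δ) {δ : ℝ} (hδ : 0 < δ) :
    HasDenseSubspace (η ⊕ θ) α δ := by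
  obtain ⟨ι, _, Hι⟩ := hη (δ / 2) (by positivity)
  obtain ⟨κ, _, Hκ⟩ := hθ (δ / (2 * (Nat.card (Subspace η α ι) + 1))) (by positivity)
  refine ⟨ι ⊕ κ, inferInstance, fun A hA => ?_⟩
  rw [mean_sumElim] at hA
  obtain ⟨V, hV⟩ := exists_popular hδ (fun y => mean_ind_le_one _) hA
    (fun (V : Subspace η α ι) y => ∀ x, Sum.elim (V x) y ∈ A)
    (fun y hy => Hι {x | Sum.elim x y ∈ A} hy)
  obtain ⟨W, hW⟩ := Hκ {y | ∀ x, Sum.elim (V x) y ∈ A} hV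
  refine ⟨prod V W, fun x => ?_⟩
  rw [prod_apply]
  exact hW _ _

/-- The multidimensional version of the density Hales–Jewett property. -/
lemma HasDenseSubspace.of_unit (h : ∀ δ > 0, HasDenseSubspace Unit α δ) (η : Type) [Finite η] :
    ∀ δ > 0, HasDenseSubspace η α δ := by
  refine Finite.induction_empty_option (P := fun η => ∀ δ > 0, HasDenseSubspace η α δ)
    ?_ ?_ ?_ η
  · exact fun e H δ hδ => (H δ hδ).reindex e (Equiv.refl α)
  · intro δ hδ
    refine ⟨PEmpty, inferInstance, fun A hA => ⟨default, fun x => ?_⟩⟩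
    by_contra hx
    have : ∀ z : PEmpty → α, ind (z ∈ A) ≤ 0 := fun z => by
      rw [Subsingleton.elim z ((default : Subspace PEmpty α PEmpty) x), ind_of_false hx]
    linarith [mean_nonpos this]
  · intro θ _ H δ hδ
    refine (HasDenseSubspace.sum H h hδ).reindex ?_ (Equiv.refl α)
    exact (Equiv.sumCongr (Equiv.refl θ) (Equiv.equivPUnit.{1, 1} Unit)).trans
      (Equiv.optionEquivSumPUnit θ).symm

end HasDenseSubspace

/-! ### Insensitive sets -/

section Insensitive

variable {α : Type}

open Classical in
/-- A dense set of words over an alphabet with an additional letter contains all points of some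
combinatorial subspace whose free coordinates avoid the additional letter. -/
lemma exists_subspace_some [Finite α] [Nonempty α] {η : Type}
    (h : ∀ δ > 0, HasDenseSubspace η α δ) {δ : ℝ} (hδ : 0 < δ) :
    ∃ (ι : Type) (_ : Finite ι), ∀ D : Set (ι → Option α), δ ≤ mean (fun x => ind (x ∈ D)) →
      ∃ V : Subspace η (Option α) ι, ∀ x : η → α, V (fun e => some (x e)) ∈ D := by
  have := Fintype.ofFinite α
  obtain ⟨n, hn⟩ := (h (δ / 2) (by positivity)).exists_forall_card
  set k : ℝ := (Fintype.card α : ℝ) with hk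
  have hk1 : 1 ≤ k := by
    rw [hk]
    exact_mod_cast Fintype.card_pos (α := α)
  obtain ⟨M, hM⟩ := exists_pow_lt_of_lt_one (show (0 : ℝ) < δ / 2 / 2 ^ n by positivity)
    (show (1 + k / 2) / (k + 1) < 1 by rw [div_lt_one (by positivity)]; linarith)
  refine ⟨Fin M, inferInstance, fun D hD => ?_⟩
  by_contra! hV
  let supp : (Fin M → Option α) → Finset (Fin M) := fun x => {i | x i ≠ none}
  have hfib : ∀ S : Finset (Fin M), ∑ x with supp x = S, ind (x ∈ D) ≤
      ∑ x with supp x = S, (δ / 2 + 2 ^ n * ∏ i, if x i = none then 1 else 2⁻¹) := by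
    intro S
    rcases lt_or_ge S.card n with hS | hS
    · refine Finset.sum_le_sum fun x hx => ?_
      have hx' : (∏ i, if x i = none then (1 : ℝ) else 2⁻¹) = 2⁻¹ ^ S.card := by
        rw [← (Finset.mem_filter.1 hx).2, Finset.prod_ite]
        simp [supp]
      have h2 : (1 : ℝ) ≤ 2 ^ n * 2⁻¹ ^ S.card := by
        rw [inv_pow, ← div_eq_mul_inv, one_le_div (by positivity)]
        exact pow_le_pow_right₀ (by norm_num) hS.le
      rw [hx']
      linarith [ind_le_one (x ∈ D)]
    · let glue : ({i // i ∈ S} → α) → Fin M → Option α :=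
        fun z i => if hi : i ∈ S then some (z ⟨i, hi⟩) else none
      have hglue : Function.Injective glue := by
        intro z w hzw
        ext i
        have := congrFun hzw i
        simpa [glue] using this
      have himage : (Finset.univ.filter fun x => supp x = S) = Finset.univ.image glue := by
        ext x
        simp only [Finset.mem_filter, Finset.mem_univ, true_and, Finset.mem_image]
        constructor
        · rintro rfl
          have hs : ∀ i : {i // i ∈ supp x}, ∃ a, x i = some a := fun i =>
            Option.ne_none_iff_exists'.1 (Finset.mem_filter.1 i.2).2
          choose z hz using hs
          refine ⟨z, funext fun i => ?_⟩
          by_cases hi : i ∈ supp x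
          · simp only [glue, hi, dif_pos]
            exact (hz ⟨i, hi⟩).symm
          · simp only [glue, hi, dif_neg, not_false_iff]
            simpa [supp, eq_comm] using hi
        · rintro ⟨z, rfl⟩
          ext i
          simp [supp, glue]
      have hmean : mean (fun z => ind (glue z ∈ D)) < δ / 2 := by
        by_contra! hc
        obtain ⟨U, hU⟩ := hn {i // i ∈ S} (by simpa using hS) {z | glue z ∈ D} hc
        let V : Subspace η (Option α) (Fin M) :=
          { idxFun := fun i => if hi : i ∈ S then (U.idxFun ⟨i, hi⟩).map some id else Sum.inl none
            proper := fun e => by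
              obtain ⟨⟨i, hi⟩, hie⟩ := U.proper e
              exact ⟨i, by simp [hi, hie]⟩ }
        obtain ⟨x, hx⟩ := hV V
        refine hx ?_
        have hVx : V (fun e => some (x e)) = glue (U x) := by
          ext1 i
          by_cases hi : i ∈ S
          · cases hu : U.idxFun ⟨i, hi⟩ <;> simp [V, Subspace.coe_apply, glue, hi, hu]
          · simp [V, Subspace.coe_apply, glue, hi]
        rw [hVx]
        exact hU x
      rw [mean_eq, div_lt_iff₀ (by positivity)] at hmean
      rw [himage, Finset.sum_image (hglue.injOn), Finset.sum_image (hglue.injOn),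
        Finset.sum_add_distrib]
      have hnonneg : 0 ≤ ∑ z, (2 : ℝ) ^ n * ∏ i, if glue z i = none then (1 : ℝ) else 2⁻¹ :=
        Finset.sum_nonneg fun z _ => mul_nonneg (by positivity)
          (Finset.prod_nonneg fun i _ => by split_ifs <;> norm_num)
      simp only [Finset.sum_const, Finset.card_univ, nsmul_eq_mul]
      linarith
  have htotal := Finset.sum_le_sum fun S (_ : S ∈ Finset.univ) => hfib S
  rw [Finset.sum_fiberwise, Finset.sum_fiberwise, Finset.sum_add_distrib, ← Finset.mul_sum,
    ← Fintype.sum_pow (fun o : Option α => if o = none then (1 : ℝ) else 2⁻¹) M,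
    Fintype.sum_option] at htotal
  rw [mean_eq, le_div_iff₀ (by positivity)] at hD
  rw [div_pow, div_lt_div_iff₀ (by positivity) (by positivity)] at hM
  simp only [Finset.sum_const, Finset.card_univ, nsmul_eq_mul, Fintype.card_pi,
    Fintype.card_option, Finset.prod_const, Fintype.card_fin, reduceCtorEq, if_true, if_false,
    Nat.cast_pow, Nat.cast_add, Nat.cast_one, ← hk] at htotal hD
  rw [← div_eq_mul_inv] at htotal
  linarith

/-- A set of words over `Option α` is insensitive at `a` if it is invariant under exchanging the
letters `none` and `some a`. -/
def Insensitive {ι : Type} (a : α) (D : Set (ι → Option α)) : Prop :=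
  ∀ x y : ι → Option α, (∀ i, (x i).getD a = (y i).getD a) → x ∈ D → y ∈ D

lemma Insensitive.compl {ι : Type} {a : α} {D : Set (ι → Option α)} (hD : Insensitive a D) :
    Insensitive a Dᶜ :=
  fun x y hxy hx hy => hx (hD y x (fun i => (hxy i).symm) hy)

lemma Insensitive.preimage {η ι : Type} {a : α} {D : Set (ι → Option α)} (hD : Insensitive a D)
    (V : Subspace η (Option α) ι) : Insensitive a {x | V x ∈ D} :=
  fun _ _ hxy hx => hD _ _ (apply_getD_congr V hxy) hx

lemma Insensitive.sumElim_left {ι κ : Type} {a : α} {D : Set (ι ⊕ κ → Option α)}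
    (hD : Insensitive a D) (y : κ → Option α) : Insensitive a {x | Sum.elim x y ∈ D} := by
  refine fun x z hxz hx => hD _ _ ?_ hx
  rintro (i | i)
  exacts [hxz i, rfl]

lemma Insensitive.sumElim_right {ι κ : Type} {a : α} {D : Set (ι ⊕ κ → Option α)}
    (hD : Insensitive a D) (x : ι → Option α) : Insensitive a {y | Sum.elim x y ∈ D} := by
  refine fun y z hyz hy => hD _ _ ?_ hy
  rintro (i | i)
  exacts [rfl, hyz i]

end Insensitive

section Correlation

variable {α : Type} [Finite α]

lemma mean_ind_range_mul {X Y : Type*} [Finite X] [Finite Y] {F : X → Y}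
    (hF : Function.Injective F) (g : Y → ℝ) :
    mean (fun y => ind (y ∈ Set.range F) * g y) =
      Nat.card X / Nat.card Y * mean (fun x => g (F x)) := by
  classical
  have := Fintype.ofFinite X
  have := Fintype.ofFinite Y
  rcases isEmpty_or_nonempty X with h | h
  · simp [mean_eq, ind_of_false]
  have hsum : ∑ y, ind (y ∈ Set.range F) * g y = ∑ x, g (F x) := by
    rw [← Finset.sum_image (s := Finset.univ) (f := g) (g := F) hF.injOn,
      ← Finset.sum_subset (Finset.subset_univ (Finset.univ.image F))]
    · refine Finset.sum_congr rfl fun y hy => ?_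
      rw [ind_of_true (by simpa using hy), one_mul]
    · intro y _ hy
      rw [ind_of_false (by simpa using hy), zero_mul]
  rw [mean_eq, mean_eq, hsum, Nat.card_eq_fintype_card, Nat.card_eq_fintype_card]
  field_simp

/-- A function which has positive correlation with an insensitive set has positive average on
some subspace contained in this set. -/
lemma exists_mean_insensitive_le [Nonempty α] {η : Type} [Finite η]
    (h : ∀ δ > 0, HasDenseSubspace η α δ) (a : α) {ε : ℝ} (hε : 0 < ε) :
    ∃ (ι : Type) (_ : Finite ι), ∀ D : Set (ι → Option α), Insensitive a D →
      ∀ g : (ι → Option α) → ℝ, (∀ x, g x ≤ 1) →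
      (∀ V : Subspace η (Option α) ι, (∀ x, V x ∈ D) → mean (fun x => g (V x)) ≤ 0) →
      mean (fun x => ind (x ∈ D) * g x) ≤ ε := by
  have hind : ∀ {ι : Type} [Finite ι] (D : Set (ι → Option α)) (g : (ι → Option α) → ℝ),
      (∀ x, g x ≤ 1) → mean (fun x => ind (x ∈ D) * g x) ≤ mean (fun x => ind (x ∈ D)) :=
    fun D g hg => mean_mono fun x => mul_le_of_le_one_right (ind_nonneg _) (hg x)
  wlog hε1 : ε ≤ 2 generalizing ε
  · obtain ⟨ι, hι, H⟩ := this (ε := 2) (by norm_num) le_rfl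
    exact ⟨ι, hι, fun D hD g hg hV => (H D hD g hg hV).trans (not_le.1 hε1).le⟩
  obtain ⟨ι₁, _, hW⟩ := exists_subspace_some h (δ := ε / 2 / 2) (by positivity)
  set c : ℝ := (Nat.card (ι₁ → Option α) : ℝ) with hc
  have hc1 : 1 ≤ c := by
    rw [hc]
    exact_mod_cast Nat.card_pos
  set t : ℝ := ε / 2 / (2 * (Nat.card (Subspace η (Option α) ι₁) + 1)) with ht
  have ht0 : 0 < t := by positivity
  have ht1 : t ≤ 1 := by
    rw [ht, div_le_one (by positivity)]
    have : (0 : ℝ) ≤ Nat.card (Subspace η (Option α) ι₁) := by positivity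
    linarith
  set γ : ℝ := t / c with hγ
  have hγ0 : 0 < γ := by positivity
  have hγ1 : γ ≤ 1 := by
    rw [hγ, div_le_one (by positivity)]
    linarith
  have key : ∀ r : ℕ, ∃ (ι : Type) (_ : Finite ι), ∀ D : Set (ι → Option α), Insensitive a D →
      ∀ g : (ι → Option α) → ℝ, (∀ x, g x ≤ 1) →
      (∀ V : Subspace η (Option α) ι, (∀ x, V x ∈ D) → mean (fun x => g (V x)) ≤ 0) →
      mean (fun x => ind (x ∈ D) * g x) ≤ ε / 2 + (1 - γ) ^ r * mean (fun x => ind (x ∈ D)) := by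
    intro r
    induction r with
    | zero =>
      refine ⟨Empty, inferInstance, fun D _ g hg _ => ?_⟩
      rw [pow_zero, one_mul]
      linarith [hind D g hg]
    | succ r ih =>
      obtain ⟨κ, _, ih⟩ := ih
      refine ⟨ι₁ ⊕ κ, inferInstance, fun D hD g hg hV => ?_⟩
      have hpow : 0 ≤ (1 - γ) ^ r := pow_nonneg (by linarith) r
      rcases lt_or_ge (mean fun x => ind (x ∈ D)) (ε / 2) with hsmall | hlarge
      · have : 0 ≤ (1 - γ) ^ (r + 1) * mean (fun x => ind (x ∈ D)) :=
          mul_nonneg (pow_nonneg (by linarith) _) (mean_nonneg fun _ => ind_nonneg _)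
        linarith [hind D g hg]
      obtain ⟨V, hX⟩ := exists_popular (half_pos hε) (fun y => mean_ind_le_one _)
        (hlarge.trans_eq (mean_sumElim _))
        (fun (V : Subspace η (Option α) ι₁) y => ∀ x, Sum.elim (V x) y ∈ D) <| by
          intro y hy
          obtain ⟨V, hVD⟩ := hW {x | Sum.elim x y ∈ D} hy
          exact ⟨V, fun x => hD.sumElim_left y _ _
            (apply_getD_congr V (a := a) fun e => by simp) (hVD fun e => (x e).getD a)⟩
      set X : Set (κ → Option α) := {y | ∀ x, Sum.elim (V x) y ∈ D} with hXdef
      have hXins : Insensitive a X := fun y z hyz hy x => hD.sumElim_right (V x) y z hyz (hy x)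
      set R : Set (ι₁ → Option α) := Set.range V with hR
      let D' : (ι₁ → Option α) → Set (κ → Option α) :=
        fun z => {y | Sum.elim z y ∈ D ∧ ¬ (z ∈ R ∧ y ∈ X)}
      have hD' : ∀ z, Insensitive a (D' z) := fun z x y hxy hx =>
        ⟨hD.sumElim_right z x y hxy hx.1,
          fun hy => hx.2 ⟨hy.1, hXins y x (fun i => (hxy i).symm) hy.2⟩⟩
      have hslice := fun z => ih (D' z) (hD' z) (fun y => g (Sum.elim z y)) (fun y => hg _)
        fun U hU => by
          have := hV (vertical z U) fun x => by
            rw [vertical_apply]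
            exact (hU x).1
          simpa only [vertical_apply] using this
      have hsplit : ∀ z y, ind (Sum.elim z y ∈ D) = ind (y ∈ D' z) + ind (z ∈ R) * ind (y ∈ X) := by
        intro z y
        by_cases hzy : z ∈ R ∧ y ∈ X
        · have hmem : Sum.elim z y ∈ D := by
            obtain ⟨⟨x, rfl⟩, hy⟩ := hzy
            exact hy x
          rw [ind_of_true hmem, ind_of_true hzy.1, ind_of_true hzy.2,
            ind_of_false fun hy : y ∈ D' z => hy.2 hzy]
          norm_num
        · have h0 : ind (z ∈ R) * ind (y ∈ X) = 0 := by
            rcases not_and_or.1 hzy with h | h <;> simp [ind_of_false h]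
          have h1 : (y ∈ D' z) = (Sum.elim z y ∈ D) :=
            propext ⟨fun hy => hy.1, fun hy => ⟨hy, hzy⟩⟩
          rw [h0, h1, add_zero]
      have hrange : (mean fun z => mean fun y =>
          ind (z ∈ R) * ind (y ∈ X) * g (Sum.elim z y)) ≤ 0 := by
        rw [mean_comm]
        refine mean_nonpos fun y => ?_
        have hcomm : ∀ z, ind (z ∈ R) * ind (y ∈ X) * g (Sum.elim z y) =
            ind (y ∈ X) * (ind (z ∈ Set.range V) * g (Sum.elim z y)) := fun z => by
          rw [hR]
          ring
        simp only [hcomm]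
        rw [mean_const_mul, mean_ind_range_mul (apply_injective V) fun z => g (Sum.elim z y)]
        by_cases hy : y ∈ X
        · have := hV (horizontal V y) fun x => by
            rw [horizontal_apply]
            exact hy x
          simp only [horizontal_apply] at this
          exact mul_nonpos_of_nonneg_of_nonpos (ind_nonneg _)
            (mul_nonpos_of_nonneg_of_nonpos (by positivity) this)
        · rw [ind_of_false hy, zero_mul]
      have hRX : γ ≤ mean fun z => mean fun y => ind (z ∈ R) * ind (y ∈ X) := by
        have hRdens : 1 / c ≤ mean fun z => ind (z ∈ R) := by
          have := mean_ind_range_mul (apply_injective V) fun _ => 1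
          simp only [mul_one, mean_const] at this
          rw [this]
          refine div_le_div_of_nonneg_right ?_ (by positivity)
          exact_mod_cast Nat.card_pos
        simp only [mean_const_mul, mul_comm (ind (_ ∈ R)) (mean _)]
        calc γ = t * (1 / c) := by rw [hγ]; ring
          _ ≤ _ := mul_le_mul hX hRdens (by positivity) (mean_nonneg fun _ => ind_nonneg _)
      have hgsplit : mean (fun x => ind (x ∈ D) * g x) =
          (mean fun z => mean fun y => ind (y ∈ D' z) * g (Sum.elim z y)) +
            mean fun z => mean fun y => ind (z ∈ R) * ind (y ∈ X) * g (Sum.elim z y) := by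
        rw [mean_sumElim', ← mean_add]
        simp only [← mean_add, hsplit, add_mul]
      have hDsplit : mean (fun x => ind (x ∈ D)) = (mean fun z => mean fun y => ind (y ∈ D' z)) +
          mean fun z => mean fun y => ind (z ∈ R) * ind (y ∈ X) := by
        rw [mean_sumElim', ← mean_add]
        simp only [← mean_add, hsplit]
      have hmain := mean_mono hslice
      rw [mean_add, mean_const, mean_const_mul] at hmain
      have hD1 := mean_ind_le_one (fun x => x ∈ D)
      have hdrop : (mean fun z => mean fun y => ind (y ∈ D' z)) ≤
          (1 - γ) * mean fun x => ind (x ∈ D) := by nlinarith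
      have := mul_le_mul_of_nonneg_left hdrop hpow
      rw [hgsplit, pow_succ, mul_assoc]
      linarith
  obtain ⟨r, hr⟩ := exists_pow_lt_of_lt_one (show 0 < ε / 2 by positivity)
    (show 1 - γ < 1 by linarith)
  obtain ⟨ι, hι, H⟩ := key r
  refine ⟨ι, hι, fun D hD g hg hV => (H D hD g hg hV).trans ?_⟩
  have : (1 - γ) ^ r * mean (fun x => ind (x ∈ D)) ≤ (1 - γ) ^ r :=
    mul_le_of_le_one_right (pow_nonneg (by linarith) r) (mean_ind_le_one _)
  linarith

open Classical in
/-- A function which has positive correlation with a union of insensitive sets has positive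
average on some subspace. -/
lemma exists_mean_iUnion_insensitive_le [Nonempty α]
    (h : ∀ (η : Type) [Finite η], ∀ δ > 0, HasDenseSubspace η α δ) (s : Finset α) :
    ∀ (η : Type) [Finite η] (ε : ℝ), 0 < ε →
      ∃ (ι : Type) (_ : Finite ι), ∀ E : α → Set (ι → Option α), (∀ a, Insensitive a (E a)) →
        ∀ f : (ι → Option α) → ℝ, (∀ x, f x ≤ 1) →
        (∀ V : Subspace η (Option α) ι, mean (fun x => f (V x)) ≤ 0) →
        mean (fun x => ind (∃ a ∈ s, x ∈ E a) * f x) ≤ ε := by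
  induction s using Finset.induction_on with
  | empty =>
    intro η _ ε hε
    refine ⟨Empty, inferInstance, fun E _ f _ _ => ?_⟩
    refine (mean_nonpos fun x => ?_).trans hε.le
    rw [ind_of_false (by simp), zero_mul]
  | insert a s _ ih =>
    intro η _ ε hε
    obtain ⟨ι, _, hι⟩ := exists_mean_insensitive_le (h η) a (ε := ε / 4) (by positivity)
    obtain ⟨κ, _, hκ⟩ := ih ι (ε / 4) (by positivity)
    refine ⟨ι ⊕ κ, inferInstance, fun E hE f hf hV => ?_⟩
    have hfirst : mean (fun x => ind (x ∈ E a) * f x) ≤ ε / 4 := by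
      rw [mean_sumElim]
      refine mean_le fun y => hι {x | Sum.elim x y ∈ E a} ((hE a).sumElim_left y)
        (fun x => f (Sum.elim x y)) (fun x => hf _) fun V _ => ?_
      simpa only [horizontal_apply] using hV (horizontal V y)
    have hrest : mean (fun x => ind (∃ b ∈ s, x ∈ E b) * (ind (x ∈ (E a)ᶜ) * f x)) ≤ ε / 2 := by
      rw [mean_sumElim']
      refine mean_le fun z => ?_
      have := hκ (fun b => {y | Sum.elim z y ∈ E b}) (fun b => (hE b).sumElim_right z)
        (fun y => ind (Sum.elim z y ∈ (E a)ᶜ) * f (Sum.elim z y) - ε / 4) ?_ ?_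
      · simp only [mul_sub, mean_sub, Set.mem_ofPred_eq] at this
        have h1 : mean (fun y => ind (∃ b ∈ s, Sum.elim z y ∈ E b) * (ε / 4)) ≤ ε / 4 :=
          mean_le fun y => mul_le_of_le_one_left (by positivity) (ind_le_one _)
        linarith
      · intro y
        have h0 := ind_nonneg (Sum.elim z y ∈ (E a)ᶜ)
        have h1 := ind_le_one (Sum.elim z y ∈ (E a)ᶜ)
        have h2 := mul_le_of_le_one_right h0 (hf (Sum.elim z y))
        linarith
      · intro V
        rw [mean_sub, mean_const, sub_nonpos]
        refine hι {x | Sum.elim z (V x) ∈ (E a)ᶜ}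
          (((hE a).compl.sumElim_right z).preimage V) (fun x => f (Sum.elim z (V x)))
          (fun x => hf _) fun U _ => ?_
        simpa only [vertical_apply, comp_apply] using hV (vertical z (comp V U))
    have hsplit : ∀ x, ind (∃ b ∈ insert a s, x ∈ E b) * f x =
        ind (x ∈ E a) * f x + ind (∃ b ∈ s, x ∈ E b) * (ind (x ∈ (E a)ᶜ) * f x) := by
      intro x
      by_cases hx : x ∈ E a
      · have h0 : ind (x ∈ (E a)ᶜ) = 0 := ind_of_false fun h => h hx
        rw [ind_of_true hx, h0, ind_of_true ⟨a, Finset.mem_insert_self a s, hx⟩]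
        ring
      · rw [ind_of_false hx, ind_of_true (show x ∈ (E a)ᶜ from hx)]
        simp [hx]
    simp only [hsplit, mean_add]
    linarith

end Correlation

/-! ### A Ramsey-type dichotomy -/

section Ramsey

lemma lift_comp {α η θ ι : Type*} (V : Subspace η α ι) (W : Subspace θ α η) (x : θ → Option α) :
    lift (comp V W) x = lift V (lift W x) := by
  ext1 i
  cases h : V.idxFun i <;> simp [lift, comp, Subspace.coe_apply, h]

/-- Given finitely many sets of words over an alphabet with an additional letter `none`, either
one of them contains all words with a fixed `none` in some subspace, or they all miss all words
with at least one `none` in some subspace. -/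
lemma exists_forall_mem_or_forall_notMem {α : Type} [Finite α] [Nonempty α]
    (η : Type) [Finite η] : ∀ (T κ : Type) [Finite T] [Finite κ],
      ∃ (ι : Type) (_ : Finite ι), ∀ G : T → Set (ι → Option α),
        (∃ t, ∃ U : Subspace (Option κ) α ι, ∀ w : κ → Option α,
          lift U (fun o => o.elim none w) ∈ G t) ∨
        ∃ U : Subspace η α ι, ∀ t, ∀ w : η → Option α, (∃ i, w i = none) → lift U w ∉ G t := by
  refine Finite.induction_empty_option (P := fun η => ∀ (T κ : Type) [Finite T] [Finite κ],
      ∃ (ι : Type) (_ : Finite ι), ∀ G : T → Set (ι → Option α),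
        (∃ t, ∃ U : Subspace (Option κ) α ι, ∀ w : κ → Option α,
          lift U (fun o => o.elim none w) ∈ G t) ∨
        ∃ U : Subspace η α ι, ∀ t, ∀ w : η → Option α, (∃ i, w i = none) → lift U w ∉ G t)
    ?_ ?_ ?_ η
  · intro η η' e H T κ _ _
    obtain ⟨ι, hι, H⟩ := H T κ
    refine ⟨ι, hι, fun G => (H G).imp_right ?_⟩
    rintro ⟨U, hU⟩
    refine ⟨U.reindex e (Equiv.refl α) (Equiv.refl ι), fun t w ⟨i, hi⟩ => ?_⟩
    have hw : lift (U.reindex e (Equiv.refl α) (Equiv.refl ι)) w = lift U (w ∘ e) := by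
      ext1 j
      cases h : U.idxFun j <;> simp [lift, Subspace.reindex, Subspace.coe_apply, h]
    rw [hw]
    exact hU t _ ⟨e.symm i, by simpa using hi⟩
  · intro T κ _ _
    exact ⟨PEmpty, inferInstance, fun G => Or.inr ⟨default, fun t w ⟨i, _⟩ => i.elim⟩⟩
  · intro η _ H T κ _ _
    obtain ⟨a₀⟩ := ‹Nonempty α›
    obtain ⟨ι₁, _, H⟩ := H (T × α) κ
    obtain ⟨ι₂, hι₂, HJ⟩ :=
      Subspace.exists_mono_in_high_dimension (Option α) (T → Prop) (ι₁ ⊕ κ)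
    refine ⟨Option ι₂, inferInstance, fun G => ?_⟩
    obtain ⟨l, c, hl⟩ := HJ fun x t => (fun o : Option ι₂ => o.elim none x) ∈ G t
    let U₀ : Subspace (Option (ι₁ ⊕ κ)) α (Option ι₂) :=
      { idxFun := fun o => o.elim (Sum.inr none) fun i =>
          (l.idxFun i).elim (fun b => b.elim (Sum.inr none) Sum.inl) fun e => Sum.inr (some e)
        proper := by
          rintro (_ | e)
          · exact ⟨none, rfl⟩
          · obtain ⟨i, hi⟩ := l.proper e
            exact ⟨some i, by simp [hi]⟩ }
    have hU₀ : ∀ w : Option (ι₁ ⊕ κ) → Option α, w none = none →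
        lift U₀ w = fun o => o.elim none (l (w ∘ some)) := by
      intro w hw
      ext1 o
      rcases o with _ | i
      · simpa [lift, Subspace.coe_apply, U₀] using hw
      · rcases h : l.idxFun i with (_ | b) | e <;>
          simp [lift, Subspace.coe_apply, U₀, h, hw]
    by_cases hc : ∃ t, c t
    · obtain ⟨t, ht⟩ := hc
      let Q : Subspace (Option κ) α (Option (ι₁ ⊕ κ)) :=
        { idxFun := fun o => o.elim (Sum.inr none)
            (Sum.elim (fun _ => Sum.inl a₀) fun e => Sum.inr (some e))
          proper := by
            rintro (_ | e)
            · exact ⟨none, rfl⟩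
            · exact ⟨some (Sum.inr e), rfl⟩ }
      refine Or.inl ⟨t, comp U₀ Q, fun w => ?_⟩
      rw [lift_comp, hU₀ _ rfl]
      rw [← hl (lift Q (fun o => o.elim none w) ∘ some)] at ht
      exact ht
    · have hnone : ∀ t, ∀ w : Option (ι₁ ⊕ κ) → Option α, w none = none → lift U₀ w ∉ G t := by
        intro t w hw hmem
        rw [hU₀ w hw] at hmem
        refine hc ⟨t, ?_⟩
        rw [← hl (w ∘ some)]
        exact hmem
      let word : Option α → (ι₁ → Option α) → Option (ι₁ ⊕ κ) → Option α :=
        fun b w o => o.elim b (Sum.elim w fun _ => some a₀)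
      rcases H fun p => {w | lift U₀ (word (some p.2) w) ∈ G p.1} with
        ⟨⟨t, a⟩, U₁, hU₁⟩ | ⟨U₁, hU₁⟩
      · let Q : Subspace (Option κ) α (Option (ι₁ ⊕ κ)) :=
          { idxFun := fun o => o.elim (Sum.inl a) (Sum.elim U₁.idxFun fun _ => Sum.inl a₀)
            proper := fun e => (U₁.proper e).elim fun i hi => ⟨some (Sum.inl i), hi⟩ }
        have hQ : ∀ w, lift Q w = word (some a) (lift U₁ w) := by
          intro w
          ext1 o
          rcases o with _ | i | i <;> rfl
        refine Or.inl ⟨t, comp U₀ Q, fun w => ?_⟩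
        rw [lift_comp, hQ]
        exact hU₁ w
      · let Q : Subspace (Option η) α (Option (ι₁ ⊕ κ)) :=
          { idxFun := fun o => o.elim (Sum.inr none)
              (Sum.elim (fun i => (U₁.idxFun i).map id some) fun _ => Sum.inl a₀)
            proper := by
              rintro (_ | e)
              · exact ⟨none, rfl⟩
              · obtain ⟨i, hi⟩ := U₁.proper e
                exact ⟨some (Sum.inl i), by simp [hi]⟩ }
        have hQ : ∀ w, lift Q w = word (w none) (lift U₁ (w ∘ some)) := by
          intro w
          ext1 o
          rcases o with _ | i | i
          · rfl
          · cases h : U₁.idxFun i <;> simp [lift, Subspace.coe_apply, Q, word, h]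
          · rfl
        refine Or.inr ⟨comp U₀ Q, fun t w hw => ?_⟩
        rw [lift_comp, hQ]
        cases h0 : w none with
        | none => exact hnone t _ rfl
        | some a =>
          obtain ⟨_ | i, hi⟩ := hw
          · rw [h0] at hi
            cases hi
          · exact hU₁ (t, a) _ ⟨i, hi⟩

end Ramsey

/-! ### Density increment -/

section Increment

variable {α : Type} [Finite α]

/-- If the density Hales–Jewett property holds for `α`, then the set of densities for which it
holds over `Option α` has no positive infimum. -/
lemma exists_lt_hasDenseSubspace [Nonempty α] (h : ∀ δ > 0, HasDenseSubspace Unit α δ) {s : ℝ}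
    (hs : 0 < s) (H : ∀ δ > s, HasDenseSubspace Unit (Option α) δ) :
    ∃ δ < s, HasDenseSubspace Unit (Option α) δ := by
  have := Fintype.ofFinite α
  obtain ⟨ι₀, _, hι₀⟩ := h (s / 2 / 2) (by positivity)
  set θ : ℝ := s / 2 / (2 * (Nat.card (Subspace Unit α ι₀) + 1)) with hθ
  have hθ0 : 0 < θ := by positivity
  obtain ⟨ιd, _, hιd⟩ := H (s + s * θ / 4) (by linarith [mul_pos hs hθ0])
  obtain ⟨κ, _, hκ⟩ := exists_mean_iUnion_insensitive_le (fun η _ => HasDenseSubspace.of_unit h η)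
    Finset.univ ιd (s * θ / 4) (by positivity)
  obtain ⟨ιM, _, hιM⟩ := exists_forall_mem_or_forall_notMem (α := α) ι₀ Unit κ
  set c : ℝ := (Nat.card (ιM → Option α) : ℝ) with hc
  have hc0 : 0 < c := by
    rw [hc]
    exact_mod_cast Nat.card_pos
  set m : ℝ := min (s / 2) (s * θ / 4) with hm
  have hm0 : 0 < m := by
    rw [hm]
    positivity
  have hm1 : m ≤ s / 2 := min_le_left _ _
  have hm2 : m ≤ s * θ / 4 := min_le_right _ _
  set ε : ℝ := m / (2 * c) with hε
  have hε0 : 0 < ε := by positivity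
  have hcε : c * (2 * ε) = m := by
    rw [hε]
    field_simp
  obtain ⟨ι₁, _, hι₁⟩ := H (s + ε) (by linarith)
  refine ⟨s - ε, by linarith, ιM ⊕ ι₁, inferInstance, fun A hA => ?_⟩
  by_contra! hline
  have hp_le : ∀ w : ιM → Option α, (mean fun y : ι₁ → Option α => ind (Sum.elim w y ∈ A)) ≤
      s + ε := by
    intro w
    by_contra! hw
    obtain ⟨V, hV⟩ := hι₁ {y | Sum.elim w y ∈ A} hw.le
    obtain ⟨x, hx⟩ := hline (vertical w V)
    rw [vertical_apply] at hx
    exact hx (hV x)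
  have hp_ge : ∀ w : ιM → Option α,
      s - m ≤ mean fun y : ι₁ → Option α => ind (Sum.elim w y ∈ A) := by
    intro w
    have := le_apply_of_le_mean hp_le (hA.trans_eq (mean_sumElim' _)) w
    rw [← hc] at this
    nlinarith
  let G : Set (ιM → Option α) := {w | θ ≤ mean fun y : ι₁ → Option α =>
    ind (∀ a, Sum.elim (fun i => some ((w i).getD a)) y ∈ A)}
  rcases hιM fun _ => G with ⟨-, U, hU⟩ | ⟨U, hU⟩
  · let N : (κ → Option α) → Option κ → Option α := fun w o => o.elim none w
    let D : (κ → Option α) → (ι₁ → Option α) → Prop := fun w y => Sum.elim (lift U (N w)) y ∈ A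
    let C : (κ → Option α) → (ι₁ → Option α) → Prop := fun w y =>
      ∀ a, Sum.elim (fun i => some ((lift U (N w) i).getD a)) y ∈ A
    have hDC : ∀ w y, C w y → ¬ D w y := by
      intro w y hC hD
      let Q : Subspace Unit (Option α) (Option κ) :=
        { idxFun := fun o => o.elim (Sum.inr ()) fun i =>
            (w i).elim (Sum.inr ()) fun a => Sum.inl (some a)
          proper := fun _ => ⟨none, rfl⟩ }
      obtain ⟨x, hx⟩ := hline (horizontal (comp (lift U) Q) y)
      rw [horizontal_apply, comp_apply] at hx
      refine hx ?_
      cases hb : x () with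
      | none =>
        have hQ : Q x = N w := by
          ext1 o
          rcases o with _ | i
          · simpa [Q, Subspace.coe_apply, N] using hb
          · cases hi : w i <;> simp [Q, Subspace.coe_apply, N, hi, hb]
        rw [hQ]
        exact hD
      | some a =>
        have hQ : Q x = fun o => some ((N w o).getD a) := by
          ext1 o
          rcases o with _ | i
          · simpa [Q, Subspace.coe_apply, N] using hb
          · cases hi : w i <;> simp [Q, Subspace.coe_apply, N, hi, hb]
        rw [hQ, lift_apply_some, ← lift_apply_getD]
        exact hC a
    have hmean : s * θ / 2 ≤ mean fun y => mean fun w => ind (D w y) -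
        (s + s * θ / 4) * (1 - ind (C w y)) := by
      simp only [mean_sub, mean_const_mul, mean_const]
      rw [mean_comm (fun y w => ind (D w y)), mean_comm (fun y w => ind (C w y))]
      have h1 : s - m ≤ mean fun w => mean fun y => ind (D w y) :=
        (mean_const _).symm.trans_le (mean_mono fun w => hp_ge _)
      have h2 : θ ≤ mean fun w => mean fun y => ind (C w y) :=
        (mean_const _).symm.trans_le (mean_mono fun w => hU w)
      nlinarith [mul_pos hs hθ0, mul_pos (mul_pos hs hθ0) hθ0]
    obtain ⟨y, hy⟩ := exists_le_of_le_mean hmean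
    have hV : ∃ V : Subspace ιd (Option α) κ,
        0 < mean fun x => ind (D (V x) y) - (s + s * θ / 4) := by
      by_contra! hV
      have := hκ (fun a => {w | Sum.elim (fun i => some ((lift U (N w) i).getD a)) y ∉ A}) ?_
        (fun w => ind (D w y) - (s + s * θ / 4)) ?_ hV
      · have hfun : ∀ w, ind (∃ a ∈ Finset.univ,
            w ∈ {w | Sum.elim (fun i => some ((lift U (N w) i).getD a)) y ∉ A}) *
              (ind (D w y) - (s + s * θ / 4)) =
            ind (D w y) - (s + s * θ / 4) * (1 - ind (C w y)) := by
          intro w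
          by_cases hw : C w y
          · rw [ind_of_true hw, ind_of_false (hDC w y hw), ind_of_false]
            · ring
            · rintro ⟨a, -, ha⟩
              exact ha (hw a)
          · rw [ind_of_false hw, ind_of_true]
            · ring
            · obtain ⟨a, ha⟩ := not_forall.1 hw
              exact ⟨a, Finset.mem_univ a, ha⟩
        simp only [hfun] at this
        linarith [mul_pos hs hθ0]
      · intro a w w' hww hw
        have hcongr : ∀ i, (lift U (N w) i).getD a = (lift U (N w') i).getD a :=
          apply_getD_congr (lift U) fun o => by
            rcases o with _ | i
            · rfl
            · exact hww i
        simpa only [Set.mem_ofPred_eq, hcongr] using hw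
      · intro w
        linarith [ind_le_one (D w y), mul_pos hs hθ0]
    obtain ⟨V, hV⟩ := hV
    rw [mean_sub, mean_const, sub_pos] at hV
    obtain ⟨L, hL⟩ := hιd {x | D (V x) y} hV.le
    let Q : Subspace Unit (Option α) (Option κ) :=
      { idxFun := fun o => o.elim (Sum.inl none) (comp V L).idxFun
        proper := fun e => ((comp V L).proper e).elim fun i hi => ⟨some i, hi⟩ }
    have hQ : ∀ x, Q x = N (V (L x)) := by
      intro x
      rw [← comp_apply]
      ext1 o
      rcases o with _ | i <;> rfl
    obtain ⟨x, hx⟩ := hline (horizontal (comp (lift U) Q) y)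
    rw [horizontal_apply, comp_apply, hQ] at hx
    exact hx (hL x)
  · have hmean : s / 2 ≤ mean fun y : ι₁ → Option α => mean fun t : ι₀ → α =>
        ind (Sum.elim (fun i => some (U t i)) y ∈ A) := by
      rw [mean_comm]
      refine (mean_const _).symm.trans_le (mean_mono fun t => ?_)
      linarith [hp_ge fun i => some (U t i)]
    obtain ⟨L, hL⟩ := exists_popular (half_pos hs) (fun y => mean_ind_le_one _) hmean
      (fun (L : Subspace Unit α ι₀) y => ∀ x, Sum.elim (fun i => some (U (L x) i)) y ∈ A)
      fun y hy => hι₀ {t | Sum.elim (fun i => some (U t i)) y ∈ A} hy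
    obtain ⟨i, hi⟩ := L.proper ()
    refine hU () (lift L fun _ => none) ⟨i, by simp [lift, Subspace.coe_apply, hi]⟩ ?_
    refine hL.trans (mean_mono fun y => ind_mono fun hy a => ?_)
    have hfun : (fun i => (lift U (lift L fun _ => none) i).getD a) = U (L fun _ => a) := by
      rw [lift_apply_getD, lift_apply_getD]
      rfl
    have := hy fun _ => a
    rw [← hfun] at this
    exact this

lemma hasDenseSubspace_option (h : ∀ δ > 0, HasDenseSubspace Unit α δ) :
    ∀ δ > 0, HasDenseSubspace Unit (Option α) δ := by
  rcases isEmpty_or_nonempty α with hα | hα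
  · refine fun δ hδ => ⟨Unit, inferInstance, fun A hA => ?_⟩
    by_contra! hV
    obtain ⟨x, hx⟩ := hV ⟨fun _ => Sum.inr (), fun _ => ⟨(), rfl⟩⟩
    have hA0 : ∀ z : Unit → Option α, ind (z ∈ A) ≤ 0 := fun z => by
      rw [ind_of_false]
      rwa [Subsingleton.elim z]
    linarith [mean_nonpos hA0]
  · intro δ hδ
    by_contra hδ'
    have hlb : ∀ δ' ∈ {δ' | HasDenseSubspace Unit (Option α) δ'}, δ ≤ δ' := fun δ' h' => by
      by_contra! hlt
      exact hδ' (h'.mono hlt.le)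
    have hne : {δ' | HasDenseSubspace Unit (Option α) δ'}.Nonempty :=
      ⟨2, hasDenseSubspace_of_one_lt Unit (by norm_num)⟩
    have hs : δ ≤ sInf {δ' | HasDenseSubspace Unit (Option α) δ'} := le_csInf hne hlb
    obtain ⟨δ₁, hlt, h₁⟩ := exists_lt_hasDenseSubspace h (hδ.trans_le hs) fun δ' h' => by
      obtain ⟨δ₂, h₂, hlt⟩ := exists_lt_of_csInf_lt hne h'
      exact HasDenseSubspace.mono h₂ hlt.le
    exact absurd (csInf_le ⟨δ, hlb⟩ h₁) (not_le.2 hlt)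

end Increment

/-- The **density Hales–Jewett theorem**. -/
theorem hasDenseSubspace_unit (α : Type) [Finite α] : ∀ δ > 0, HasDenseSubspace Unit α δ := by
  have key : ∃ _ : Finite α, ∀ δ > 0, HasDenseSubspace Unit α δ := by
    refine Finite.induction_empty_option
      (P := fun α => ∃ _ : Finite α, ∀ δ > 0, HasDenseSubspace Unit α δ) ?_ ?_ ?_ α
    · rintro α β e ⟨_, hα⟩
      have := Finite.of_equiv α e
      exact ⟨this, fun δ hδ => (hα δ hδ).reindex (Equiv.refl Unit) e⟩
    · exact ⟨inferInstance, fun δ _ => ⟨Unit, inferInstance, fun A _ =>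
        ⟨⟨fun _ => Sum.inr (), fun _ => ⟨(), rfl⟩⟩, fun x => (x ()).elim⟩⟩⟩
    · rintro α _ ⟨_, hα⟩
      exact ⟨inferInstance, hasDenseSubspace_option hα⟩
  exact key.2

/-! ### From words to grids -/

section Grid

variable {k : ℕ} {ι : Type} [Fintype ι]

/-- The vector counting the occurrences of each letter `some i` in a word. -/
def letterCount (x : ι → Option (Fin k)) : Fin k → ℤ :=
  ∑ j, (x j).elim 0 fun i => Pi.single i 1

lemma letterCount_nonneg (x : ι → Option (Fin k)) (i : Fin k) : 0 ≤ letterCount x i := by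
  rw [letterCount, Finset.sum_apply]
  refine Finset.sum_nonneg fun j _ => ?_
  rcases x j with _ | l
  · exact le_rfl
  · simp only [Option.elim_some, Pi.single_apply]
    split_ifs <;> norm_num

lemma letterCount_le (x : ι → Option (Fin k)) (i : Fin k) :
    letterCount x i ≤ Fintype.card ι := by
  rw [letterCount, Finset.sum_apply]
  refine (Finset.sum_le_card_nsmul _ _ 1 fun j _ => ?_).trans_eq (by simp)
  rcases x j with _ | l
  · simp
  · simp only [Option.elim_some, Pi.single_apply]
    split_ifs <;> norm_num

open Classical in
lemma letterCount_subspace_apply (V : Subspace Unit (Option (Fin k)) ι) (i : Fin k) :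
    letterCount (V fun _ => some i) = letterCount (V fun _ => none) +
      (Finset.card {j | V.idxFun j = Sum.inr ()} : ℤ) • Pi.single i (1 : ℤ) := by
  have hj : ∀ j, ((V fun _ => some i) j).elim 0 (fun l => Pi.single l (1 : ℤ)) =
      ((V fun _ => none) j).elim 0 (fun l => Pi.single l (1 : ℤ)) +
        if V.idxFun j = Sum.inr () then Pi.single i (1 : ℤ) else 0 := by
    intro j
    cases h : V.idxFun j <;> simp [Subspace.coe_apply, h]
  simp only [letterCount, hj, Finset.sum_add_distrib, ← Finset.sum_filter, Finset.sum_const,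
    natCast_zsmul]

/-- Some translate of a dense subset of a large grid is dense when pulled back to words. -/
lemma exists_le_mean_letterCount {δ : ℝ} {N : ℕ} (hN : 0 < N) (hcard : Fintype.card ι ≤ N)
    {A : Finset (Fin k → ℤ)} (hA : ∀ p ∈ A, ∀ i, 1 ≤ p i ∧ p i ≤ (N : ℤ))
    (hδ : δ * (N : ℝ) ^ k ≤ A.card) (hδ0 : 0 < δ) :
    ∃ a : Fin k → ℤ, δ / 2 ^ k ≤
      mean fun x : ι → Option (Fin k) => ind (a + letterCount x ∈ A) := by
  classical
  by_contra! hlt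
  let S : Finset (Fin k → ℤ) :=
    Fintype.piFinset fun _ => Finset.Icc (1 - (Fintype.card ι : ℤ)) N
  have hS : (S.card : ℝ) ≤ 2 ^ k * N ^ k := by
    have h1 : S.card = (N + Fintype.card ι) ^ k := by
      simp only [S, Fintype.card_piFinset, Int.card_Icc, Finset.prod_const, Finset.card_univ,
        Fintype.card_fin]
      congr 1
      omega
    rw [h1, ← mul_pow]
    push_cast
    have : (Fintype.card ι : ℝ) ≤ N := by exact_mod_cast hcard
    exact pow_le_pow_left₀ (by positivity) (by linarith) k
  have hSne : S.Nonempty := by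
    refine ⟨fun _ => N, ?_⟩
    simp only [S, Fintype.mem_piFinset, Finset.mem_Icc]
    omega
  have hcount : ∀ x : ι → Option (Fin k),
      (A.card : ℝ) ≤ ∑ a ∈ S, ind (a + letterCount x ∈ A) := by
    intro x
    have hsub : A.image (fun p => p - letterCount x) ⊆ S := by
      intro a ha
      obtain ⟨p, hp, rfl⟩ := Finset.mem_image.1 ha
      simp only [S, Fintype.mem_piFinset, Finset.mem_Icc, Pi.sub_apply]
      intro i
      have h1 := hA p hp i
      have h2 := letterCount_nonneg x i
      have h3 := letterCount_le x i
      omega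
    refine le_trans (le_of_eq ?_)
      (Finset.sum_le_sum_of_subset_of_nonneg hsub fun a _ _ => ind_nonneg _)
    rw [Finset.sum_image (sub_left_injective.injOn), Finset.cast_card]
    refine Finset.sum_congr rfl fun p hp => ?_
    rw [sub_add_cancel, ind_of_true hp]
  have h1 := mean_mono hcount
  rw [mean_const, mean_sum] at h1
  have h2 : _ < ∑ _a ∈ S, δ / 2 ^ k := Finset.sum_lt_sum_of_nonempty hSne fun a _ => hlt a
  rw [Finset.sum_const, nsmul_eq_mul] at h2
  have h3 : (S.card : ℝ) * (δ / 2 ^ k) ≤ 2 ^ k * N ^ k * (δ / 2 ^ k) :=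
    mul_le_mul_of_nonneg_right hS (by positivity)
  have h4 : (2 : ℝ) ^ k * N ^ k * (δ / 2 ^ k) = δ * N ^ k := by
    field_simp
  linarith

end Grid

end DensityHalesJewett

/-- **Theorem 10.2.** Let `δ > 0` and `k` a positive integer. If `N` is sufficiently large then
every subset `A` of the grid `{1,…,N}^k` of size at least `δ·N^k` contains a set of points of
the form `{a} ∪ {a + d • e i : 1 ≤ i ≤ k}`, where `e 1, …, e k` is the standard basis of `ℤ^k`
and `d` is a non-zero integer. -/
theorem corners_multidim (δ : ℝ) (hδ : 0 < δ) (k : ℕ) (hk : 0 < k) :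
    ∃ N₀ : ℕ, ∀ N : ℕ, N₀ ≤ N → ∀ A : Finset (Fin k → ℤ),
      (∀ p ∈ A, ∀ i, 1 ≤ p i ∧ p i ≤ (N : ℤ)) →
      δ * (N : ℝ) ^ k ≤ (A.card : ℝ) →
      ∃ (a : Fin k → ℤ) (d : ℤ), d ≠ 0 ∧ a ∈ A ∧
        ∀ i : Fin k, a + d • Pi.single i (1 : ℤ) ∈ A := by
  classical
  obtain ⟨ι, _, hι⟩ := DensityHalesJewett.hasDenseSubspace_unit (Option (Fin k)) (δ / 2 ^ k)
    (by positivity)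
  have := Fintype.ofFinite ι
  refine ⟨Fintype.card ι + 1, fun N hN A hA hcard => ?_⟩
  obtain ⟨a, ha⟩ := DensityHalesJewett.exists_le_mean_letterCount (ι := ι) (by omega) (by omega)
    hA hcard hδ
  obtain ⟨V, hV⟩ := hι {x | a + DensityHalesJewett.letterCount x ∈ A} ha
  obtain ⟨j, hj⟩ := V.proper ()
  refine ⟨a + DensityHalesJewett.letterCount (V fun _ => none),
    (Finset.card {j | V.idxFun j = Sum.inr ()} : ℤ), ?_, hV _, fun i => ?_⟩
  · exact_mod_cast (Finset.card_pos.2 ⟨j, by simpa using hj⟩).ne'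
  · rw [add_assoc, ← DensityHalesJewett.letterCount_subspace_apply]
    exact hV _
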